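/- For every integer q ≥ 1 and every real y: (a) P_q(−1, y, 1) = 0, and (b) (∂P_q/∂x)(−1, y, 1) = 0, where ∂P_q/∂x is the partial derivative of the polynomial P_q with respect to its first variable. -/

import Mathlib

open Finset

/-- `a_q(l) = 1/(l!(q-l)!) · 1/(2l-1)`. -/
noncomputable def aCoeff (q l : ℕ) : ℝ :=
  (1 / ((l.factorial : ℝ) * ((q - l).factorial : ℝ))) * (1 / (2 * (l : ℝ) - 1))

/-- `b_q(l₁,l₂,n)`; all factorial arguments are non-negative in the admissible
range (we use truncated subtraction on `ℕ`). -/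
noncomputable def bCoeff (q l₁ l₂ n : ℕ) : ℝ :=
  ((2 * q - 2 * l₁).factorial * (2 * l₁).factorial *
      (2 * q - 2 * l₂).factorial * (2 * l₂).factorial : ℝ) /
    ((2 * q + n - 2 * l₁ - 2 * l₂).factorial * (2 * l₁ - n).factorial *
      (2 * l₂ - n).factorial * n.factorial : ℝ)

/-- `c_q = 2^{4q} (q!)² / (2q · (2q)!)`. -/
noncomputable def cCoeff (q : ℕ) : ℝ :=
  2 ^ (4 * q) * (q.factorial : ℝ) ^ 2 / (2 * (q : ℝ) * ((2 * q).factorial : ℝ))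

/-- The polynomial function `P̃_q(x,y,z)`. -/
noncomputable def Ptilde (q : ℕ) (x y z : ℝ) : ℝ :=
  ∑ l₁ ∈ range (q + 1), ∑ l₂ ∈ range (q + 1),
    aCoeff q l₁ * aCoeff q l₂ *
      ∑ n ∈ Finset.Icc (2 * (l₁ + l₂) - 2 * q) (min (2 * l₁) (2 * l₂)),
        bCoeff q l₁ l₂ n * x ^ (2 * q + n - 2 * l₁ - 2 * l₂) *
          y ^ (2 * (l₁ + l₂) - 2 * n) * z ^ n

/-- `P_q(x,y,z) = P̃_q(x,y,z) + c_q(x^{2q-1}z + (2q-1)x^{2q-2}y²)`. -/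
noncomputable def Ppoly (q : ℕ) (x y z : ℝ) : ℝ :=
  Ptilde q x y z + cCoeff q * (x ^ (2 * q - 1) * z + (2 * (q : ℝ) - 1) * x ^ (2 * q - 2) * y ^ 2)

open Polynomial

/-- The weighted binomial sum `∑ⱼ φ(j) sʲ tᴺ⁻ʲ / (j! (N-j)!)`. -/
noncomputable def binomSum {R : Type*} [CommRing R] [Algebra ℂ R] (N : ℕ) (φ : ℕ → ℂ) (s t : R) :
    R :=
  ∑ j ∈ range (N + 1),
    (φ j / ((j.factorial : ℂ) * ((N - j).factorial : ℂ))) • (s ^ j * t ^ (N - j))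

section BinomSum

variable {R : Type*} [CommRing R] [Algebra ℂ R]

lemma succ_mul_div_factorial (M j : ℕ) (c : ℂ) :
    ((j : ℂ) + 1) * c / (((j + 1).factorial : ℂ) * ((M + 1 - (j + 1)).factorial : ℂ)) =
      c / ((j.factorial : ℂ) * ((M - j).factorial : ℂ)) := by
  have h1 : (j.factorial : ℂ) ≠ 0 := by exact_mod_cast j.factorial_ne_zero
  have h2 : ((M - j).factorial : ℂ) ≠ 0 := by exact_mod_cast (M - j).factorial_ne_zero
  have h3 : (j : ℂ) + 1 ≠ 0 := by exact_mod_cast j.succ_ne_zero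
  rw [Nat.add_sub_add_right, Nat.factorial_succ]
  push_cast
  field_simp

lemma sub_mul_div_factorial {M j : ℕ} (hj : j ≤ M) (c : ℂ) :
    ((M : ℂ) + 1 - j) * c / ((j.factorial : ℂ) * ((M + 1 - j).factorial : ℂ)) =
      c / ((j.factorial : ℂ) * ((M - j).factorial : ℂ)) := by
  obtain ⟨d, rfl⟩ := Nat.exists_eq_add_of_le hj
  have h1 : (j.factorial : ℂ) ≠ 0 := by exact_mod_cast j.factorial_ne_zero
  have h2 : (d.factorial : ℂ) ≠ 0 := by exact_mod_cast d.factorial_ne_zero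
  have h3 : (d : ℂ) + 1 ≠ 0 := by exact_mod_cast d.succ_ne_zero
  rw [show j + d + 1 - j = d + 1 by omega, show j + d - j = d by omega, Nat.factorial_succ]
  push_cast
  rw [show (j : ℂ) + d + 1 - j = d + 1 by ring]
  field_simp

lemma binomSum_index_mul (M : ℕ) (ψ : ℕ → ℂ) (s t : R) :
    binomSum (M + 1) (fun j => j * ψ (j - 1)) s t = s * binomSum M ψ s t := by
  unfold binomSum
  rw [sum_range_succ']
  simp only [Nat.cast_zero, zero_mul, zero_div, zero_smul, add_zero, mul_sum]
  refine sum_congr rfl fun j _ => ?_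
  rw [Nat.cast_succ, Nat.add_sub_cancel, succ_mul_div_factorial, Nat.add_sub_add_right,
    mul_smul_comm]
  ring_nf

lemma binomSum_coindex_mul (M : ℕ) (ψ : ℕ → ℂ) (s t : R) :
    binomSum (M + 1) (fun j => ((M : ℂ) + 1 - j) * ψ j) s t = t * binomSum M ψ s t := by
  unfold binomSum
  rw [sum_range_succ]
  simp only [Nat.cast_succ, sub_self, zero_mul, zero_div, zero_smul, add_zero, mul_sum]
  refine sum_congr rfl fun j hj => ?_
  have hj : j ≤ M := by simpa [Nat.lt_succ_iff] using hj
  rw [sub_mul_div_factorial hj, mul_smul_comm, Nat.succ_sub hj, pow_succ]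
  ring_nf

lemma binomSum_add (N : ℕ) (φ ψ : ℕ → ℂ) (s t : R) :
    binomSum N (fun j => φ j + ψ j) s t = binomSum N φ s t + binomSum N ψ s t := by
  simp only [binomSum, add_div, add_smul, sum_add_distrib]

lemma binomSum_const_mul (N : ℕ) (c : ℂ) (φ : ℕ → ℂ) (s t : R) :
    binomSum N (fun j => c * φ j) s t = c • binomSum N φ s t := by
  simp only [binomSum, mul_div_assoc, mul_smul, smul_sum]

lemma binomSum_congr {N : ℕ} {φ ψ : ℕ → ℂ} (h : ∀ j ≤ N, φ j = ψ j) (s t : R) :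
    binomSum N φ s t = binomSum N ψ s t :=
  sum_congr rfl fun j hj => by rw [h j (by simpa [Nat.lt_succ_iff] using hj)]

lemma binomSum_sub_mul (M : ℕ) (ψ : ℕ → ℂ) (s t : R) :
    (s - t) * binomSum M ψ s t =
      binomSum (M + 1) (fun j => j * ψ (j - 1) - ((M : ℂ) + 1 - j) * ψ j) s t := by
  rw [sub_mul, ← binomSum_index_mul, ← binomSum_coindex_mul]
  simp only [binomSum, sub_div, sub_smul, sum_sub_distrib]

lemma binomSum_one (N : ℕ) (s t : R) :
    binomSum N (fun _ => 1) s t = (1 / (N.factorial : ℂ)) • (s + t) ^ N := by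
  rw [binomSum, add_pow, smul_sum]
  refine sum_congr rfl fun j hj => ?_
  have hj : j ≤ N := by simpa [Nat.lt_succ_iff] using hj
  have h0 : (N.factorial : ℂ) ≠ 0 := by exact_mod_cast N.factorial_ne_zero
  have h1 : s ^ j * t ^ (N - j) * (N.choose j : R) = (N.choose j : ℂ) • (s ^ j * t ^ (N - j)) := by
    rw [Nat.cast_smul_eq_nsmul, nsmul_eq_mul, mul_comm]
  rw [h1, smul_smul, Nat.cast_choose ℂ hj]
  congr 1
  field_simp

/-- The first moment of the binomial sum. -/
lemma binomSum_linear (N : ℕ) (s t : R) :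
    binomSum N (fun j => 2 * (j : ℂ) - N) s t =
      ((N : ℂ) / (N.factorial : ℂ)) • ((s - t) * (s + t) ^ (N - 1)) := by
  cases N with
  | zero => simp [binomSum]
  | succ M =>
    have h := binomSum_sub_mul M (fun _ => 1) s t
    rw [binomSum_one, mul_smul_comm] at h
    have h0 : (M.factorial : ℂ) ≠ 0 := by exact_mod_cast M.factorial_ne_zero
    have h1 : (M : ℂ) + 1 ≠ 0 := by exact_mod_cast M.succ_ne_zero
    rw [Nat.factorial_succ, Nat.add_sub_cancel]
    push_cast
    rw [div_mul_cancel_left₀ h1, ← one_div, h]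
    exact binomSum_congr (fun j _ => by ring) s t

/-- The second moment of the binomial sum. -/
lemma binomSum_sq (M : ℕ) (s t : R) :
    binomSum (M + 1) (fun j => (2 * (j : ℂ) - (M + 1)) ^ 2) s t =
      ((M : ℂ) / (M.factorial : ℂ)) • ((s - t) ^ 2 * (s + t) ^ (M - 1)) +
        (1 / (M.factorial : ℂ)) • (s + t) ^ (M + 1) := by
  have h := binomSum_sub_mul M (fun j => 2 * (j : ℂ) - M) s t
  rw [binomSum_linear, mul_smul_comm, ← mul_assoc, ← sq] at h
  have h0 : (M.factorial : ℂ) ≠ 0 := by exact_mod_cast M.factorial_ne_zero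
  have h1 : (M : ℂ) + 1 ≠ 0 := by exact_mod_cast M.succ_ne_zero
  have h2 : (1 / (M.factorial : ℂ)) • (s + t) ^ (M + 1) =
      ((M : ℂ) + 1) • binomSum (M + 1) (fun _ => 1) s t := by
    rw [binomSum_one, smul_smul, Nat.factorial_succ]
    congr 1
    push_cast
    field_simp
  rw [h, h2, ← binomSum_const_mul, ← binomSum_add]
  refine binomSum_congr (fun j _ => ?_) s t
  cases j with
  | zero => push_cast; ring
  | succ i => rw [Nat.add_sub_cancel]; push_cast; ring

/-- The product-rule expansion of a derivative of `binomSum`, regrouped by monomials. -/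
lemma sum_derivative_eq_binomSum (M : ℕ) (φ : ℕ → ℂ) (s t s' t' : R) :
    ∑ j ∈ range (M + 1 + 1), (φ j / ((j.factorial : ℂ) * ((M + 1 - j).factorial : ℂ))) •
        ((j * s ^ (j - 1) * s') * t ^ (M + 1 - j) +
          s ^ j * (((M + 1 - j : ℕ) : R) * t ^ (M + 1 - j - 1) * t')) =
      s' * binomSum M (fun j => φ (j + 1)) s t + t' * binomSum M φ s t := by
  simp only [smul_add, sum_add_distrib]
  congr 1
  · rw [sum_range_succ', binomSum, mul_sum]
    simp only [Nat.cast_zero, zero_mul, smul_zero, add_zero]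
    refine sum_congr rfl fun j _ => ?_
    rw [← succ_mul_div_factorial M j, mul_div_assoc, mul_smul, Nat.add_sub_cancel,
      Nat.add_sub_add_right, ← Nat.cast_succ, Nat.cast_smul_eq_nsmul, nsmul_eq_mul,
      Algebra.mul_smul_comm, Algebra.mul_smul_comm]
    congr 1
    ring
  · rw [sum_range_succ, binomSum, mul_sum]
    simp only [Nat.sub_self, Nat.cast_zero, zero_mul, mul_zero, smul_zero, add_zero]
    refine sum_congr rfl fun j hj => ?_
    have hj : j ≤ M := by simpa [Nat.lt_succ_iff] using hj
    rw [← sub_mul_div_factorial hj, mul_div_assoc, mul_smul,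
      show (M : ℂ) + 1 - j = ((M + 1 - j : ℕ) : ℂ) by push_cast [Nat.le_succ_of_le hj]; ring,
      Nat.cast_smul_eq_nsmul, nsmul_eq_mul, Algebra.mul_smul_comm, Algebra.mul_smul_comm,
      show M + 1 - j - 1 = M - j by omega]
    congr 1
    ring

lemma map_binomSum {S : Type*} [CommRing S] [Algebra ℂ S] (f : R →ₐ[ℂ] S) (N : ℕ) (φ : ℕ → ℂ)
    (s t : R) : f (binomSum N φ s t) = binomSum N φ (f s) (f t) := by
  simp [binomSum, map_sum]

lemma binomSum_reflect (N : ℕ) (φ : ℕ → ℂ) (s t : R) :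
    binomSum N φ s t = binomSum N (fun j => φ (N - j)) t s := by
  unfold binomSum
  rw [← sum_range_reflect]
  refine sum_congr rfl fun j hj => ?_
  have hj : j ≤ N := by simpa [Nat.lt_succ_iff] using hj
  rw [show N + 1 - 1 - j = N - j by omega, Nat.sub_sub_self hj, mul_comm (s ^ _),
    mul_comm ((N - j).factorial : ℂ)]

end BinomSum

/-- The homogeneous form `∑ₗ a_q(l) u^{2q-2l} v^{2l}`. -/
noncomputable def aForm {R : Type*} [CommRing R] [Algebra ℂ R] (q : ℕ) (u v : R) : R :=
  ∑ l ∈ range (q + 1), (aCoeff q l : ℂ) • (u ^ (2 * q - 2 * l) * v ^ (2 * l))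

/-- The absolute difference `|j - q|`, as a complex number. -/
noncomputable def absDiff (q j : ℕ) : ℂ := ((|(j : ℤ) - q| : ℤ) : ℂ)

lemma map_aForm {R S : Type*} [CommRing R] [Algebra ℂ R] [CommRing S] [Algebra ℂ S]
    (f : R →ₐ[ℂ] S) (q : ℕ) (u v : R) : f (aForm q u v) = aForm q (f u) (f v) := by
  simp only [aForm, map_sum, map_smul, map_mul, map_pow]

lemma absDiff_of_le {q j : ℕ} (h : j ≤ q) : absDiff q j = q - j := by
  rw [absDiff, abs_of_nonpos (by omega)]
  push_cast
  ring

lemma absDiff_of_ge {q j : ℕ} (h : q ≤ j) : absDiff q j = j - q := by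
  rw [absDiff, abs_of_nonneg (by omega)]
  push_cast
  ring

lemma absDiff_reflect {q j : ℕ} (h : j ≤ 2 * q) : absDiff q (2 * q - j) = absDiff q j := by
  rcases le_total j q with h' | h'
  · rw [absDiff_of_le h', absDiff_of_ge (by omega)]
    push_cast [h]
    ring
  · rw [absDiff_of_ge h', absDiff_of_le (by omega)]
    push_cast [h]
    ring

lemma absDiff_sq (q j : ℕ) : absDiff q j * absDiff q j = ((j : ℂ) - q) ^ 2 := by
  rcases le_total j q with h | h
  · rw [absDiff_of_le h]; ring
  · rw [absDiff_of_ge h]; ring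

lemma absDiff_add_succ_sq (q j : ℕ) :
    (absDiff q (j + 1) + absDiff q j) * (absDiff q (j + 1) + absDiff q j) =
      (2 * (j : ℂ) + 1 - 2 * q) ^ 2 := by
  rcases Nat.lt_or_ge j q with h | h
  · rw [absDiff_of_le h, absDiff_of_le h.le]; push_cast; ring
  · rw [absDiff_of_ge h, absDiff_of_ge (by omega : q ≤ j + 1)]; push_cast; ring

/-- The Euler-type equation satisfied by the binomial sum with weights `|j - q|`. -/
lemma binomSum_absDiff_euler {R : Type*} [CommRing R] [Algebra ℂ R] (p : ℕ) (s t : R) :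
    (1 / 2 : ℂ) • ((s - t) * binomSum (2 * p + 1)
        (fun j => absDiff (p + 1) (j + 1) - absDiff (p + 1) j) s t) -
      binomSum (2 * p + 1 + 1) (absDiff (p + 1)) s t =
    (-((p : ℂ) + 1) / (((p + 1).factorial : ℂ) * ((p + 1).factorial : ℂ))) •
      (s * t) ^ (p + 1) := by
  rw [binomSum_sub_mul, ← binomSum_const_mul, sub_eq_iff_eq_add]
  have h : ∀ j ≤ 2 * p + 1 + 1,
      (1 / 2 : ℂ) * (j * (absDiff (p + 1) (j - 1 + 1) - absDiff (p + 1) (j - 1)) -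
        (((2 * p + 1 : ℕ) : ℂ) + 1 - j) * (absDiff (p + 1) (j + 1) - absDiff (p + 1) j)) =
      (if j = p + 1 then -((p : ℂ) + 1) else 0) + absDiff (p + 1) j := by
    intro j _
    rcases lt_trichotomy j (p + 1) with h | h | h
    · rw [if_neg h.ne, absDiff_of_le h.le, absDiff_of_le (show j + 1 ≤ p + 1 by omega)]
      cases j with
      | zero => push_cast; ring
      | succ i =>
        rw [Nat.add_sub_cancel, absDiff_of_le h.le, absDiff_of_le (show i ≤ p + 1 by omega)]
        push_cast; ring
    · subst h
      rw [if_pos rfl, Nat.add_sub_cancel, absDiff_of_le le_rfl,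
        absDiff_of_le (show p ≤ p + 1 by omega),
        absDiff_of_ge (show p + 1 ≤ p + 1 + 1 by omega)]
      push_cast; ring
    · obtain ⟨i, rfl⟩ := Nat.exists_eq_add_of_lt h
      rw [if_neg h.ne', Nat.add_sub_cancel, absDiff_of_ge (show p + 1 ≤ p + 1 + i + 1 by omega),
        absDiff_of_ge (show p + 1 ≤ p + 1 + i by omega),
        absDiff_of_ge (show p + 1 ≤ p + 1 + i + 1 + 1 by omega)]
      push_cast; ring
  rw [binomSum_congr h, binomSum_add]
  congr 1
  rw [binomSum, sum_eq_single (p + 1)]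
  · rw [if_pos rfl, show 2 * p + 1 + 1 - (p + 1) = p + 1 by omega, mul_pow]
  · intro j _ hj
    simp [hj]
  · intro h
    simp only [mem_range] at h
    omega

lemma two_mul_cast_sub_one_ne_zero (l : ℕ) : (2 * (l : ℂ) - 1) ≠ 0 := by
  intro h
  have h2 : ((2 * (l : ℤ) - 1 : ℤ) : ℂ) = 0 := by push_cast; exact h
  have := Int.cast_eq_zero.mp h2
  omega

/-- The Euler-type equation satisfied by the form with coefficients `a_q(l)`. -/
lemma aForm_euler (q : ℕ) (u v : ℂ) :
    X * derivative (aForm q (C u) (C v * X)) - aForm q (C u) (C v * X) =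
      (1 / (q.factorial : ℂ)) • (C u ^ 2 + (C v * X) ^ 2) ^ q := by
  rw [add_comm (C u ^ 2), ← binomSum_one, aForm, derivative_sum, mul_sum, ← sum_sub_distrib,
    binomSum]
  refine sum_congr rfl fun l _ => ?_
  have h : X * derivative ((C v * X) ^ (2 * l)) = (2 * l : ℂ) • (C v * X) ^ (2 * l) := by
    cases l with
    | zero => simp
    | succ n =>
      rw [derivative_pow, derivative_C_mul, derivative_X, show 2 * (n + 1) - 1 = 2 * n + 1 by omega,
        smul_eq_C_mul]
      simp only [C_mul, map_natCast, map_ofNat]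
      push_cast
      ring
  have h1 : derivative (C u ^ (2 * q - 2 * l)) = 0 := by rw [← C_pow, derivative_C]
  rw [derivative_smul, derivative_mul, h1, zero_mul, zero_add, mul_smul_comm, mul_left_comm, h,
    ← smul_sub, mul_smul_comm, ← pow_mul, ← pow_mul, Nat.mul_sub,
    mul_comm ((C v * X) ^ (2 * l))]
  rw [show ((2 * l : ℂ) • (C u ^ (2 * q - 2 * l) * (C v * X) ^ (2 * l)) -
      C u ^ (2 * q - 2 * l) * (C v * X) ^ (2 * l)) =
      (2 * l - 1 : ℂ) • (C u ^ (2 * q - 2 * l) * (C v * X) ^ (2 * l)) by rw [sub_smul, one_smul],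
    smul_smul]
  congr 1
  have := two_mul_cast_sub_one_ne_zero l
  have h3 : (l.factorial : ℂ) ≠ 0 := by exact_mod_cast l.factorial_ne_zero
  have h4 : ((q - l).factorial : ℂ) ≠ 0 := by exact_mod_cast (q - l).factorial_ne_zero
  rw [aCoeff]
  push_cast
  field_simp

lemma eval_neg_of_X_mul_derivative_eq {D : ℂ[X]} (h : X * derivative D = D) (z : ℂ) :
    D.eval (-z) = - D.eval z := by
  have h1 : D = C (D.coeff 1) * X := by
    ext n
    rw [coeff_C_mul, coeff_X]
    rcases n with _ | _ | n
    · rw [← h]; simp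
    · simp
    · have h2 := congrArg (fun p => p.coeff (n + 2)) h
      simp only [coeff_X_mul, coeff_derivative] at h2
      have h3 : D.coeff (n + 2) * ((n : ℂ) + 1) = 0 := by
        push_cast at h2
        linear_combination h2
      have h4 : (n : ℂ) + 1 ≠ 0 := by exact_mod_cast n.succ_ne_zero
      simpa [h4] using h3
  rw [h1]
  simp

/-- The form with coefficients `a_q(l)` in the coordinates `u ± iv`. -/
lemma aForm_eq_binomSum (p : ℕ) (u v : ℂ) :
    aForm (p + 1) u v = (-(p.factorial : ℂ)) •
      binomSum (2 * p + 1 + 1) (absDiff (p + 1)) (u + Complex.I * v) (u - Complex.I * v) := by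
  set s : ℂ[X] := C u + C (Complex.I * v) * X with hs
  set t : ℂ[X] := C u - C (Complex.I * v) * X with ht
  set P : ℂ[X] := aForm (p + 1) (C u) (C v * X) with hP
  set Q : ℂ[X] := (-(p.factorial : ℂ)) • binomSum (2 * p + 1 + 1) (absDiff (p + 1)) s t with hQ
  have hs' : derivative s = C (Complex.I * v) := by simp [hs]
  have ht' : derivative t = -C (Complex.I * v) := by simp [ht]
  have hst : s * t = C u ^ 2 + (C v * X) ^ 2 := by
    have hI : (C Complex.I : ℂ[X]) ^ 2 = -1 := by rw [← C_pow, Complex.I_sq]; simp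
    rw [hs, ht, C_mul]
    linear_combination (- (C v * X) ^ 2) * hI
  have hder : derivative (binomSum (2 * p + 1 + 1) (absDiff (p + 1)) s t) =
      C (Complex.I * v) * binomSum (2 * p + 1)
        (fun j => absDiff (p + 1) (j + 1) - absDiff (p + 1) j) s t := by
    have h := sum_derivative_eq_binomSum (2 * p + 1) (absDiff (p + 1)) s t
      (derivative s) (derivative t)
    have h2 : binomSum (2 * p + 1) (fun j => absDiff (p + 1) (j + 1) - absDiff (p + 1) j) s t =
      binomSum (2 * p + 1) (fun j => absDiff (p + 1) (j + 1)) s t -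
        binomSum (2 * p + 1) (absDiff (p + 1)) s t := by
      simp only [binomSum, sub_div, sub_smul, sum_sub_distrib]
    rw [h2, mul_sub, sub_eq_add_neg, ← neg_mul, ← ht', ← hs', ← h, binomSum, derivative_sum]
    refine sum_congr rfl fun j _ => ?_
    rw [derivative_smul, derivative_mul, derivative_pow, derivative_pow]
    simp only [map_natCast]
  have hQe : X * derivative Q - Q =
      (1 / ((p + 1).factorial : ℂ)) • (C u ^ 2 + (C v * X) ^ 2) ^ (p + 1) := by
    have h := binomSum_absDiff_euler p s t
    rw [hst] at h
    have h1 : X * derivative (binomSum (2 * p + 1 + 1) (absDiff (p + 1)) s t) =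
        (1 / 2 : ℂ) • ((s - t) * binomSum (2 * p + 1)
          (fun j => absDiff (p + 1) (j + 1) - absDiff (p + 1) j) s t) := by
      rw [hder, ← smul_mul_assoc, ← mul_assoc]
      congr 1
      rw [hs, ht, smul_eq_C_mul]
      have : (C (1 / 2 : ℂ) : ℂ[X]) * 2 = 1 := by
        rw [← map_ofNat C, ← C_mul]; norm_num
      linear_combination (-C (Complex.I * v) * X) * this
    rw [← h1] at h
    rw [hQ, derivative_smul, mul_smul_comm, ← smul_sub, h, smul_smul]
    congr 1
    have h3 : (p.factorial : ℂ) ≠ 0 := by exact_mod_cast p.factorial_ne_zero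
    have h4 : (p : ℂ) + 1 ≠ 0 := by exact_mod_cast p.succ_ne_zero
    rw [Nat.factorial_succ]
    push_cast
    field_simp
  have hD : X * derivative (P - Q) = P - Q := by
    have h := aForm_euler (p + 1) u v
    rw [← hP, ← hQe] at h
    rw [derivative_sub]
    linear_combination h
  have evP : ∀ z : ℂ, P.eval z = aForm (p + 1) u (v * z) := fun z => by
    rw [hP, ← coe_aeval_eq_eval, map_aForm]; simp
  have evQ : ∀ z : ℂ, Q.eval z = (-(p.factorial : ℂ)) • binomSum (2 * p + 1 + 1) (absDiff (p + 1))
      (u + Complex.I * v * z) (u - Complex.I * v * z) := fun z => by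
    rw [hQ, eval_smul, ← coe_aeval_eq_eval, map_binomSum]; simp [hs, ht]
  have h1 := eval_neg_of_X_mul_derivative_eq hD 1
  rw [eval_sub, eval_sub, evP, evP, evQ, evQ, binomSum_reflect] at h1
  have h2 : aForm (p + 1) u (v * -1) = aForm (p + 1) u v := by
    simp [aForm, pow_mul]
  have h3 : ∀ j ≤ 2 * p + 1 + 1, absDiff (p + 1) (2 * p + 1 + 1 - j) = absDiff (p + 1) j :=
    fun j hj => absDiff_reflect hj
  rw [h2, binomSum_congr h3] at h1
  simp only [mul_one, mul_neg, sub_neg_eq_add, ← sub_eq_add_neg] at h1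
  linear_combination h1 / 2

lemma aForm_polynomial_eq_binomSum (p : ℕ) (u v : ℂ[X]) :
    aForm (p + 1) u v = (-(p.factorial : ℂ)) •
      binomSum (2 * p + 1 + 1) (absDiff (p + 1)) (u + C Complex.I * v) (u - C Complex.I * v) := by
  refine Polynomial.funext fun z => ?_
  rw [eval_smul, ← coe_aeval_eq_eval, map_aForm, map_binomSum, aForm_eq_binomSum]
  simp

/-- The linear functional on `ℂ[X]` representing the Fischer product with the form `aForm`. -/
noncomputable def aPairing (q : ℕ) : ℂ[X] →ₗ[ℂ] ℂ :=
  ∑ l ∈ range (q + 1),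
    ((aCoeff q l : ℂ) * ((2 * q - 2 * l).factorial * (2 * l).factorial)) • lcoeff ℂ (2 * l)

lemma aPairing_apply (q : ℕ) (f : ℂ[X]) :
    aPairing q f = ∑ l ∈ range (q + 1),
      ((aCoeff q l : ℂ) * ((2 * q - 2 * l).factorial * (2 * l).factorial)) * f.coeff (2 * l) := by
  simp [aPairing, LinearMap.sum_apply]

lemma coeff_linear_pow (a b : ℂ) (n k : ℕ) :
    ((C a + C b * X) ^ n).coeff k = (n.choose k : ℂ) * a ^ (n - k) * b ^ k := by
  have h : ((C a + C b * X) ^ n).coeff k =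
      ∑ m ∈ range (n + 1), if k = m then (n.choose m : ℂ) * a ^ (n - m) * b ^ m else 0 := by
    rw [add_comm, add_pow, finsetSum_coeff]
    refine sum_congr rfl fun m _ => ?_
    rw [mul_pow, ← C_pow, ← C_pow, ← C_eq_natCast, coeff_mul_C, coeff_mul_C, coeff_C_mul,
      coeff_X_pow]
    split_ifs <;> ring
  rw [h, sum_ite_eq]
  split_ifs with hk
  · rfl
  · rw [Nat.choose_eq_zero_of_lt (by simpa using hk)]
    simp

lemma aPairing_linear_pow (q : ℕ) (a b : ℂ) :
    aPairing q ((C a + C b * X) ^ (2 * q)) = ((2 * q).factorial : ℂ) * aForm q a b := by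
  rw [aPairing_apply, aForm, mul_sum]
  refine sum_congr rfl fun l hl => ?_
  have hl : 2 * l ≤ 2 * q := by simp only [mem_range] at hl; omega
  rw [coeff_linear_pow, Nat.cast_choose ℂ hl, smul_eq_mul]
  have h3 : ((2 * l).factorial : ℂ) ≠ 0 := by exact_mod_cast Nat.factorial_ne_zero _
  have h4 : ((2 * q - 2 * l).factorial : ℂ) ≠ 0 := by exact_mod_cast Nat.factorial_ne_zero _
  field_simp

/-- The functional is diagonal in the basis of monomials in `1 ± iX`. -/
lemma aPairing_basis (p j : ℕ) (hj : j ≤ 2 * p + 1 + 1) :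
    aPairing (p + 1) ((1 - C Complex.I * X) ^ j * (1 + C Complex.I * X) ^ (2 * p + 1 + 1 - j)) =
      -(p.factorial : ℂ) * 2 ^ (2 * p + 2) * absDiff (p + 1) j := by
  set N := 2 * p + 1 + 1 with hN
  have key : (∑ i ∈ range (N + 1), C ((N.choose i : ℂ) * aPairing (p + 1)
      ((1 - C Complex.I * X) ^ i * (1 + C Complex.I * X) ^ (N - i))) * X ^ i : ℂ[X]) =
      ∑ i ∈ range (N + 1), C ((N.choose i : ℂ) *
        (-(p.factorial : ℂ) * 2 ^ (2 * p + 2) * absDiff (p + 1) i)) * X ^ i := by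
    refine Polynomial.funext fun τ => ?_
    have h := aPairing_linear_pow (p + 1) (1 + τ) (Complex.I * (1 - τ))
    have h1 : (C (1 + τ) + C (Complex.I * (1 - τ)) * X : ℂ[X]) =
        C τ * (1 - C Complex.I * X) + (1 + C Complex.I * X) := by
      simp only [C_add, C_mul, C_sub, C_1]
      ring
    have h2 : (1 + τ) + Complex.I * (Complex.I * (1 - τ)) = 2 * τ := by
      linear_combination (1 - τ) * Complex.I_sq
    have h3 : (1 + τ) - Complex.I * (Complex.I * (1 - τ)) = 2 := by
      linear_combination -(1 - τ) * Complex.I_sq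
    rw [h1, aForm_eq_binomSum, h2, h3, show 2 * (p + 1) = N by omega, ← hN, add_pow, map_sum,
      binomSum, smul_sum, mul_sum] at h
    simp only [eval_finsetSum, eval_mul, eval_C, eval_pow, eval_X]
    convert h using 1
    · refine sum_congr rfl fun i _ => ?_
      have : ((C τ * (1 - C Complex.I * X)) ^ i * (1 + C Complex.I * X) ^ (N - i) *
          (N.choose i : ℂ[X])) = ((N.choose i : ℂ) * τ ^ i) •
          ((1 - C Complex.I * X) ^ i * (1 + C Complex.I * X) ^ (N - i)) := by
        rw [smul_eq_C_mul, mul_pow, C_mul, C_pow, map_natCast]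
        ring
      rw [this, map_smul, smul_eq_mul]
      ring
    · refine sum_congr rfl fun i hi => ?_
      have hi : i ≤ N := by simpa [Nat.lt_succ_iff] using hi
      have h4 : (2 : ℂ) ^ (2 * p + 2) = 2 ^ i * 2 ^ (N - i) := by
        rw [← pow_add]; congr 1; omega
      rw [Nat.cast_choose ℂ hi, h4, smul_eq_mul, smul_eq_mul, mul_pow]
      ring
  have h := congrArg (fun f => f.coeff j) key
  simp only [finsetSum_coeff, coeff_C_mul, coeff_X_pow, mul_ite, mul_one, mul_zero, sum_ite_eq,
    mem_range, Nat.lt_succ_of_le hj, if_true] at h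
  exact mul_left_cancel₀ (by exact_mod_cast (Nat.choose_pos hj).ne') h

lemma aPairing_basis_pred (p j : ℕ) (hj : j ≤ 2 * p + 1) :
    aPairing (p + 1) ((1 - C Complex.I * X) ^ j * (1 + C Complex.I * X) ^ (2 * p + 1 - j)) =
      -(p.factorial : ℂ) * 2 ^ (2 * p + 1) * (absDiff (p + 1) (j + 1) + absDiff (p + 1) j) := by
  have h1 := aPairing_basis p j (by omega)
  have h2 := aPairing_basis p (j + 1) (by omega)
  rw [Nat.add_sub_add_right] at h2
  rw [show 2 * p + 1 + 1 - j = 2 * p + 1 - j + 1 by omega] at h1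
  have h : (2 : ℂ) • ((1 - C Complex.I * X) ^ j * (1 + C Complex.I * X) ^ (2 * p + 1 - j)) =
      (1 - C Complex.I * X) ^ (j + 1) * (1 + C Complex.I * X) ^ (2 * p + 1 - j) +
      (1 - C Complex.I * X) ^ j * (1 + C Complex.I * X) ^ (2 * p + 1 - j + 1) := by
    rw [smul_eq_C_mul, map_ofNat]
    ring
  have h3 := congrArg (aPairing (p + 1)) h
  rw [map_smul, map_add, h1, h2, smul_eq_mul] at h3
  linear_combination h3 / 2

lemma aPairing_binomSum {q N : ℕ} {s t : ℂ[X]} {κ : ℂ} {ψ : ℕ → ℂ}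
    (h : ∀ j ≤ N, aPairing q (s ^ j * t ^ (N - j)) = κ * ψ j) (φ : ℕ → ℂ) (β γ : ℂ) :
    aPairing q (binomSum N φ (C β * s) (C γ * t)) =
      κ * binomSum N (fun j => φ j * ψ j) β γ := by
  rw [binomSum, map_sum, binomSum, mul_sum]
  refine sum_congr rfl fun j hj => ?_
  have hj : j ≤ N := by simpa [Nat.lt_succ_iff] using hj
  have h1 : (C β * s) ^ j * (C γ * t) ^ (N - j) =
      (β ^ j * γ ^ (N - j)) • (s ^ j * t ^ (N - j)) := by
    rw [smul_eq_C_mul, C_mul, C_pow, C_pow]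
    ring
  rw [h1, map_smul, map_smul, h j hj]
  simp only [smul_eq_mul]
  ring

/-- Coefficientwise differentiability of a polynomial-valued function. -/
def HasCoeffDerivAt (f : ℂ → ℂ[X]) (f' : ℂ[X]) (x : ℂ) : Prop :=
  ∀ k, HasDerivAt (fun z => (f z).coeff k) (f'.coeff k) x

namespace HasCoeffDerivAt

variable {f g : ℂ → ℂ[X]} {f' g' : ℂ[X]} {x : ℂ}

lemma mul (hf : HasCoeffDerivAt f f' x) (hg : HasCoeffDerivAt g g' x) :
    HasCoeffDerivAt (fun z => f z * g z) (f' * g x + f x * g') x := by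
  intro k
  simp only [coeff_add, coeff_mul, ← sum_add_distrib]
  exact HasDerivAt.fun_sum fun i _ => (hf i.1).mul (hg i.2)

lemma const_smul (c : ℂ) (hf : HasCoeffDerivAt f f' x) :
    HasCoeffDerivAt (fun z => c • f z) (c • f') x := by
  intro k
  simp only [coeff_smul, smul_eq_mul]
  exact (hf k).const_mul c

lemma sum {ι : Type*} {S : Finset ι} {F : ι → ℂ → ℂ[X]} {F' : ι → ℂ[X]}
    (h : ∀ i ∈ S, HasCoeffDerivAt (F i) (F' i) x) :
    HasCoeffDerivAt (fun z => ∑ i ∈ S, F i z) (∑ i ∈ S, F' i) x := by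
  intro k
  simp only [finsetSum_coeff]
  exact HasDerivAt.fun_sum fun i hi => h i hi k

lemma C_add_const (r : ℂ[X]) (x : ℂ) : HasCoeffDerivAt (fun z => C z + r) 1 x := by
  intro k
  simp only [coeff_add, coeff_C, coeff_one]
  split_ifs
  · exact (hasDerivAt_id x).add_const _
  · exact hasDerivAt_const _ _

lemma pow (hf : HasCoeffDerivAt f f' x) (n : ℕ) :
    HasCoeffDerivAt (fun z => f z ^ n) (n * f x ^ (n - 1) * f') x := by
  induction n with
  | zero =>
    intro k
    simpa using hasDerivAt_const x _
  | succ n ih =>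
    simp only [pow_succ]
    convert ih.mul hf using 1
    rcases n with _ | n
    · simp
    · simp only [Nat.add_sub_cancel]
      push_cast
      ring

lemma aPairing (hf : HasCoeffDerivAt f f' x) (q : ℕ) :
    HasDerivAt (fun z => aPairing q (f z)) (aPairing q f') x := by
  simp only [aPairing_apply]
  exact HasDerivAt.fun_sum fun l _ => (hf _).const_mul _

lemma binomSum (M : ℕ) (φ : ℕ → ℂ) (hf : HasCoeffDerivAt f f' x) (hg : HasCoeffDerivAt g g' x) :
    HasCoeffDerivAt (fun z => binomSum (M + 1) φ (f z) (g z))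
      (f' * binomSum M (fun j => φ (j + 1)) (f x) (g x) + g' * binomSum M φ (f x) (g x)) x := by
  rw [← sum_derivative_eq_binomSum]
  exact sum fun j _ => ((hf.pow j).mul (hg.pow (M + 1 - j))).const_smul _

end HasCoeffDerivAt

lemma coeff_linear_pow_mul_linear_pow (x y : ℂ) (a b k : ℕ) :
    ((C x + C y * X) ^ a * (C y + X) ^ b).coeff k =
      ∑ n ∈ Icc (k - a) (min k b), (b.choose n : ℂ) * y ^ (b - n) *
        ((a.choose (k - n) : ℂ) * x ^ (a - (k - n)) * y ^ (k - n)) := by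
  have h : (C y + X : ℂ[X]) = C y + C 1 * X := by simp
  rw [h, mul_comm, coeff_mul, Nat.sum_antidiagonal_eq_sum_range_succ_mk]
  simp only [coeff_linear_pow, one_pow, mul_one]
  symm
  refine sum_subset (fun n hn => ?_) (fun n _ hn => ?_)
  · simp only [mem_Icc, mem_range, le_min_iff] at hn ⊢
    omega
  · simp only [mem_Icc, mem_range, le_min_iff, not_and_or, not_le] at *
    rcases Nat.lt_or_ge b n with h1 | h1
    · simp [Nat.choose_eq_zero_of_lt h1]
    · rw [Nat.choose_eq_zero_of_lt (show a < k - n by omega)]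
      simp

lemma ofReal_Ptilde (q : ℕ) (x y : ℝ) :
    ((Ptilde q x y 1 : ℝ) : ℂ) =
      aPairing q (aForm q (C (x : ℂ) + C (y : ℂ) * X) (C (y : ℂ) + X)) := by
  rw [aPairing_apply, Ptilde, Complex.ofReal_sum]
  refine sum_congr rfl fun l hl => ?_
  rw [aForm, finsetSum_coeff, mul_sum, Complex.ofReal_sum]
  refine sum_congr rfl fun m hm => ?_
  rw [mem_range] at hl hm
  rw [coeff_smul, coeff_linear_pow_mul_linear_pow, smul_eq_mul,
    show 2 * l - (2 * q - 2 * m) = 2 * (l + m) - 2 * q by omega]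
  simp only [mul_sum, Complex.ofReal_sum]
  refine sum_congr rfl fun n hn => ?_
  simp only [mem_Icc, le_min_iff] at hn
  rw [Nat.cast_choose ℂ (show n ≤ 2 * m by omega),
    Nat.cast_choose ℂ (show 2 * l - n ≤ 2 * q - 2 * m by omega), bCoeff,
    show 2 * q - 2 * m - (2 * l - n) = 2 * q + n - 2 * l - 2 * m by omega,
    show 2 * (l + m) - 2 * n = (2 * m - n) + (2 * l - n) by omega, pow_add]
  push_cast
  ring

lemma coordinates_eq (y : ℂ) :
    C (-1) + C y * X + C Complex.I * (C y + X) =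
        C (-1 + Complex.I * y) * (1 - C Complex.I * X) ∧
      C (-1) + C y * X - C Complex.I * (C y + X) =
        C (-1 - Complex.I * y) * (1 + C Complex.I * X) := by
  have hI : (C Complex.I : ℂ[X]) ^ 2 = -1 := by rw [← C_pow, Complex.I_sq]; simp
  constructor
  · simp only [C_add, C_mul]
    rw [C_neg, C_1]
    linear_combination (C y * X) * hI
  · simp only [C_sub, C_mul]
    rw [C_neg, C_1]
    linear_combination (C y * X) * hI

lemma cCoeff_succ (p : ℕ) :
    cCoeff (p + 1) = 4 ^ (2 * p + 1) * (p.factorial : ℝ) ^ 2 / ((2 * p + 1).factorial : ℝ) := by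
  have h1 : ((2 * p + 1).factorial : ℝ) ≠ 0 := by exact_mod_cast Nat.factorial_ne_zero _
  have h2 : (p : ℝ) + 1 ≠ 0 := by exact_mod_cast p.succ_ne_zero
  rw [cCoeff, show 2 * (p + 1) = 2 * p + 1 + 1 by omega, Nat.factorial_succ (2 * p + 1),
    Nat.factorial_succ p, show 4 * (p + 1) = 2 * (2 * p + 1) + 2 by omega, pow_add, pow_mul]
  push_cast
  field_simp
  ring

lemma aPairing_aForm_neg_one (p : ℕ) (y : ℂ) :
    aPairing (p + 1) (aForm (p + 1) (C (-1) + C y * X) (C y + X)) =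
      4 ^ (2 * p + 1) * (p.factorial : ℂ) ^ 2 / ((2 * p + 1).factorial : ℂ) *
        (1 - (2 * p + 1) * y ^ 2) := by
  rw [aForm_polynomial_eq_binomSum, (coordinates_eq y).1, (coordinates_eq y).2, map_smul,
    aPairing_binomSum (aPairing_basis p)]
  have h : ∀ j ≤ 2 * p + 1 + 1, absDiff (p + 1) j * absDiff (p + 1) j =
      1 / 4 * (2 * (j : ℂ) - (((2 * p + 1 : ℕ) : ℂ) + 1)) ^ 2 := fun j _ => by
    rw [absDiff_sq]; push_cast; ring
  rw [binomSum_congr h, binomSum_const_mul, binomSum_sq, Nat.add_sub_cancel,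
    show -1 + Complex.I * y - (-1 - Complex.I * y) = 2 * (Complex.I * y) by ring,
    show -1 + Complex.I * y + (-1 - Complex.I * y) = -2 by ring, mul_pow, mul_pow, Complex.I_sq,
    pow_succ (-2 : ℂ) (2 * p + 1), pow_succ (-2 : ℂ) (2 * p), (even_two_mul p).neg_pow,
    show (4 : ℂ) ^ (2 * p + 1) = 4 * (2 ^ (2 * p)) ^ 2 by
      rw [← pow_mul, pow_succ, show (4 : ℂ) = 2 ^ 2 by norm_num, ← pow_mul]; ring,
    pow_add 2 (2 * p) 2]
  simp only [smul_eq_mul]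
  generalize (2 : ℂ) ^ (2 * p) = e
  push_cast
  ring

lemma hasDerivAt_aPairing_aForm_neg_one (p : ℕ) (y : ℂ) :
    HasDerivAt (fun x => aPairing (p + 1) (aForm (p + 1) (C x + C y * X) (C y + X)))
      (-(4 ^ (2 * p + 1) * (p.factorial : ℂ) ^ 2 / ((2 * p + 1).factorial : ℂ) *
        ((2 * p + 1) * (1 - 2 * p * y ^ 2)))) (-1) := by
  have hs := HasCoeffDerivAt.C_add_const (C y * X + C Complex.I * (C y + X)) (-1)
  have ht := HasCoeffDerivAt.C_add_const (C y * X - C Complex.I * (C y + X)) (-1)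
  have h := ((HasCoeffDerivAt.binomSum (2 * p + 1) (absDiff (p + 1)) hs ht).const_smul
    (-(p.factorial : ℂ))).aPairing (p + 1)
  simp only [← add_assoc, ← add_sub_assoc, ← aForm_polynomial_eq_binomSum] at h
  convert h using 1
  rw [(coordinates_eq y).1, (coordinates_eq y).2, map_smul, one_mul, one_mul, ← binomSum_add,
    aPairing_binomSum (aPairing_basis_pred p)]
  have h1 : ∀ j ≤ 2 * p + 1, (absDiff (p + 1) (j + 1) + absDiff (p + 1) j) *
      (absDiff (p + 1) (j + 1) + absDiff (p + 1) j) =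
      (2 * (j : ℂ) - (((2 * p : ℕ) : ℂ) + 1)) ^ 2 := fun j _ => by
    rw [absDiff_add_succ_sq]; push_cast; ring
  rw [binomSum_congr h1, binomSum_sq,
    show -1 + Complex.I * y - (-1 - Complex.I * y) = 2 * (Complex.I * y) by ring,
    show -1 + Complex.I * y + (-1 - Complex.I * y) = -2 by ring, mul_pow, mul_pow, Complex.I_sq,
    show (4 : ℂ) = 2 ^ 2 by norm_num, ← pow_mul]
  have h2 : ((2 * p).factorial : ℂ) ≠ 0 := by exact_mod_cast Nat.factorial_ne_zero _
  have h3 : 2 * (p : ℂ) + 1 ≠ 0 := by exact_mod_cast (2 * p).succ_ne_zero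
  have h4 : ((2 * p : ℕ) : ℂ) * (-2) ^ (2 * p - 1) = -(p : ℂ) * 2 ^ (2 * p) := by
    rcases p with _ | p
    · simp
    · rw [show 2 * (p + 1) - 1 = 2 * p + 1 by omega, show 2 * (p + 1) = 2 * p + 2 by omega,
        pow_succ, pow_add, (even_two_mul p).neg_pow]
      push_cast
      ring
  have h5 : (-2 : ℂ) ^ (2 * p + 1) = -2 * 2 ^ (2 * p) := by
    rw [pow_succ, (even_two_mul p).neg_pow]; ring
  have h6 : ((2 * p : ℕ) : ℂ) / ((2 * p).factorial : ℂ) *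
      (2 ^ 2 * (-1 * y ^ 2) * (-2) ^ (2 * p - 1)) =
      4 * y ^ 2 * p * 2 ^ (2 * p) / ((2 * p).factorial : ℂ) := by
    linear_combination (-4 * y ^ 2 / ((2 * p).factorial : ℂ)) * h4
  rw [h5, smul_eq_mul, smul_eq_mul, smul_eq_mul, h6, Nat.factorial_succ]
  push_cast
  field_simp
  ring

/-- For every `q ≥ 1` and every real `y`:
(a) `P_q(−1, y, 1) = 0`, and (b) `(∂P_q/∂x)(−1, y, 1) = 0`. -/
theorem Ppoly_vanishing (q : ℕ) (hq : 1 ≤ q) (y : ℝ) :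
    Ppoly q (-1) y 1 = 0 ∧ deriv (fun x : ℝ => Ppoly q x y 1) (-1) = 0 := by
  obtain ⟨p, rfl⟩ := Nat.exists_eq_add_of_le' hq
  have hexp : 2 * (p + 1) - 1 = 2 * p + 1 ∧ 2 * (p + 1) - 2 = 2 * p := by omega
  have hodd : (-1 : ℝ) ^ (2 * p + 1) = -1 := (odd_two_mul_add_one p).neg_one_pow
  have heven : (-1 : ℝ) ^ (2 * p) = 1 := (even_two_mul p).neg_one_pow
  constructor
  · have h : Ptilde (p + 1) (-1) y 1 = cCoeff (p + 1) * (1 - (2 * p + 1) * y ^ 2) := by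
      have h := ofReal_Ptilde (p + 1) (-1) y
      rw [Complex.ofReal_neg, Complex.ofReal_one, aPairing_aForm_neg_one] at h
      apply Complex.ofReal_injective
      rw [h, cCoeff_succ]
      push_cast
      ring
    rw [Ppoly, h, hexp.1, hexp.2, hodd, heven]
    push_cast
    ring
  · have h : HasDerivAt (fun x : ℝ => Ptilde (p + 1) x y 1)
        (-(cCoeff (p + 1) * ((2 * p + 1) * (1 - 2 * p * y ^ 2)))) (-1) := by
      have h := hasDerivAt_aPairing_aForm_neg_one p y
      rw [show (-1 : ℂ) = ((-1 : ℝ) : ℂ) by simp] at h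
      have h1 := h.real_of_complex
      simp only [← ofReal_Ptilde, Complex.ofReal_re] at h1
      rw [cCoeff_succ]
      convert h1 using 1
      rw [← Complex.ofReal_re (-_)]
      congr 1
      push_cast
      ring
    have h2 := h.add ((((hasDerivAt_pow (2 * p + 1) (-1 : ℝ)).mul_const (1 : ℝ)).add
      (((hasDerivAt_pow (2 * p) (-1 : ℝ)).const_mul (2 * ((p + 1 : ℕ) : ℝ) - 1)).mul_const
        (y ^ 2))).const_mul (cCoeff (p + 1)))
    have h3 : ((2 * p : ℕ) : ℝ) * (-1) ^ (2 * p - 1) = -(2 * p) := by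
      rcases p with _ | p
      · simp
      · rw [show 2 * (p + 1) - 1 = 2 * p + 1 by omega, (odd_two_mul_add_one p).neg_one_pow]
        push_cast
        ring
    simp only [Ppoly, hexp.1, hexp.2]
    refine (h2.congr_deriv ?_).deriv
    rw [h3, Nat.add_sub_cancel, heven]
    push_cast
    ring
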